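/- For every Borel measurable function f : (0, ∞) → [0, +∞], limsup_{α→0+} ( α · ∫_{(0,∞)} e^{−αt} f(t) dt ) ≤ limsup_{T→+∞} ( (1/T) · ∫_{(0,T)} f(t) dt ), where the integrals are Lebesgue integrals with values in [0, +∞] (with the convention α·(+∞) := +∞ for α > 0), the limsup on the left is taken as α tends to 0 through positive values, and the limsup on the right is taken as T tends to +∞. -/

import Mathlib

open Filter Topology MeasureTheory ENNReal

lemma aux_exp (α : ℝ) (hα : 0 < α) (t : ℝ) :
    ∫⁻ s in Set.Ioi t, ENNReal.ofReal (α * Real.exp (-(α * s)))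
      = ENNReal.ofReal (Real.exp (-(α * t))) := by
  have hi : IntegrableOn (fun s : ℝ => α * Real.exp (-(α * s))) (Set.Ioi t) := by
    have := (integrableOn_exp_mul_Ioi (a := -α) (by linarith) t).const_mul α
    simpa [IntegrableOn] using this
  rw [← ofReal_integral_eq_lintegral_ofReal hi
    (Eventually.of_forall fun s => by positivity)]
  congr 1
  have := integral_exp_mul_Ioi (a := -α) (by linarith) t
  rw [integral_const_mul]
  simp only [neg_mul] at this
  rw [this]
  field_simp

lemma aux_tonelli (f : ℝ → ℝ≥0∞) (hf : Measurable f) (α : ℝ) (hα : 0 < α) :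
    ∫⁻ t in Set.Ioi (0 : ℝ), ENNReal.ofReal (Real.exp (-(α * t))) * f t
      = ∫⁻ s in Set.Ioi (0 : ℝ), ENNReal.ofReal (α * Real.exp (-(α * s))) *
          ∫⁻ t in Set.Ioo (0 : ℝ) s, f t := by
  have hw : Measurable fun s : ℝ => ENNReal.ofReal (α * Real.exp (-(α * s))) := by fun_prop
  have h1 : ∀ t ∈ Set.Ioi (0:ℝ), ENNReal.ofReal (Real.exp (-(α * t))) * f t
      = ∫⁻ s in Set.Ioi (0:ℝ), {p : ℝ × ℝ | p.1 < p.2}.indicator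
        (fun p => ENNReal.ofReal (α * Real.exp (-(α * p.2))) * f p.1) (t, s) := by
    intro t ht
    rw [← aux_exp α hα t, ← lintegral_mul_const _ hw]
    have : ∀ s, {p : ℝ × ℝ | p.1 < p.2}.indicator
        (fun p => ENNReal.ofReal (α * Real.exp (-(α * p.2))) * f p.1) (t, s)
        = (Set.Ioi t).indicator
          (fun s => ENNReal.ofReal (α * Real.exp (-(α * s))) * f t) s := by
      intro s; simp [Set.indicator]
    simp_rw [this]
    rw [lintegral_indicator measurableSet_Ioi, Measure.restrict_restrict measurableSet_Ioi,
      Set.inter_eq_left.2 (Set.Ioi_subset_Ioi (le_of_lt ht))]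
  have h2 : ∀ s ∈ Set.Ioi (0:ℝ), ENNReal.ofReal (α * Real.exp (-(α * s))) *
          ∫⁻ t in Set.Ioo (0 : ℝ) s, f t
      = ∫⁻ t in Set.Ioi (0:ℝ), {p : ℝ × ℝ | p.1 < p.2}.indicator
        (fun p => ENNReal.ofReal (α * Real.exp (-(α * p.2))) * f p.1) (t, s) := by
    intro s hs
    rw [← lintegral_const_mul _ hf]
    have : ∀ t, {p : ℝ × ℝ | p.1 < p.2}.indicator
        (fun p => ENNReal.ofReal (α * Real.exp (-(α * p.2))) * f p.1) (t, s)
        = (Set.Iio s).indicator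
          (fun t => ENNReal.ofReal (α * Real.exp (-(α * s))) * f t) t := by
      intro t; simp [Set.indicator]
    simp_rw [this]
    rw [lintegral_indicator measurableSet_Iio, Measure.restrict_restrict measurableSet_Iio,
      Set.inter_comm, Set.Ioi_inter_Iio]
  rw [setLIntegral_congr_fun measurableSet_Ioi h1, setLIntegral_congr_fun measurableSet_Ioi h2]
  apply lintegral_lintegral_swap
  apply Measurable.aemeasurable
  apply Measurable.indicator
  · fun_prop
  · exact measurableSet_lt measurable_fst measurable_snd

theorem aux_bound (f : ℝ → ℝ≥0∞) (hf : Measurable f) (c K : ℝ≥0∞)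
    (h : ∀ s > 0, ∫⁻ t in Set.Ioo (0 : ℝ) s, f t ≤ c * ENNReal.ofReal s + K)
    (α : ℝ) (hα : 0 < α) :
    ENNReal.ofReal α *
      ∫⁻ t in Set.Ioi (0 : ℝ), ENNReal.ofReal (Real.exp (-(α * t))) * f t
      ≤ c + ENNReal.ofReal α * K := by
  have hw : Measurable fun s : ℝ => ENNReal.ofReal (α * Real.exp (-(α * s))) := by fun_prop
  have hc := aux_tonelli (fun _ => c) measurable_const α hα
  have hone := aux_exp α hα 0
  simp only [mul_zero, neg_zero, Real.exp_zero, ENNReal.ofReal_one] at hone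
  calc _ ≤ ENNReal.ofReal α * ∫⁻ s in Set.Ioi (0 : ℝ),
          (ENNReal.ofReal (α * Real.exp (-(α * s))) * (∫⁻ t in Set.Ioo (0 : ℝ) s, c)
          + ENNReal.ofReal (α * Real.exp (-(α * s))) * K) := by
        rw [aux_tonelli f hf α hα]
        gcongr 1
        apply setLIntegral_mono' measurableSet_Ioi
        intro s hs
        rw [← mul_add]
        gcongr
        simpa using h s hs
    _ = ENNReal.ofReal α * ((∫⁻ t in Set.Ioi (0 : ℝ), 
          ENNReal.ofReal (Real.exp (-(α * t))) * c) + K) := by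
        rw [lintegral_add_right _ (hw.mul_const K), ← hc, lintegral_mul_const _ hw, hone, one_mul]
    _ = c + ENNReal.ofReal α * K := by
        rw [mul_add, lintegral_mul_const _ (by fun_prop), ← mul_assoc,
          ← lintegral_const_mul _ (by fun_prop)]
        simp_rw [← ENNReal.ofReal_mul hα.le]
        rw [hone, one_mul]

/-- For every Borel measurable `f : (0,∞) → [0, +∞]`,
`limsup_{α→0+} α ∫_{(0,∞)} e^{−αt} f(t) dt ≤ limsup_{T→+∞} (1/T) ∫_{(0,T)} f(t) dt`. -/
theorem stmt8 (f : ℝ → ℝ≥0∞) (hf : Measurable f) :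
    limsup (fun α : ℝ =>
        ENNReal.ofReal α *
          ∫⁻ t in Set.Ioi (0 : ℝ), ENNReal.ofReal (Real.exp (-(α * t))) * f t)
      (nhdsWithin 0 (Set.Ioi (0 : ℝ)))
    ≤ limsup (fun T : ℝ =>
        ENNReal.ofReal (1 / T) * ∫⁻ t in Set.Ioo (0 : ℝ) T, f t) atTop := by
  apply le_of_forall_gt_imp_ge_of_dense
  intro c hc
  rcases eq_or_ne c ⊤ with rfl | hct
  · exact le_top
  have hev := eventually_lt_of_limsup_lt hc
  obtain ⟨T₁, hT₁⟩ := eventually_atTop.1 hev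
  have hF : ∀ T ≥ max T₁ 1, ∫⁻ t in Set.Ioo (0 : ℝ) T, f t ≤ c * ENNReal.ofReal T := by
    intro T hT
    have hpos : 0 < T := lt_of_lt_of_le one_pos (le_trans (le_max_right _ _) hT)
    have h := (hT₁ T (le_trans (le_max_left _ _) hT)).le
    rw [one_div, ENNReal.ofReal_inv_of_pos hpos, mul_comm, ← div_eq_mul_inv] at h
    exact (ENNReal.div_le_iff (by simpa using hpos) ofReal_ne_top).1 h
  have hb := aux_bound f hf c (c * ENNReal.ofReal (max T₁ 1)) (by
    intro s hs
    rcases le_total (max T₁ 1) s with h | h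
    · exact (hF s h).trans le_self_add
    · exact ((lintegral_mono_set (Set.Ioo_subset_Ioo_right h)).trans (hF _ le_rfl)).trans
        le_add_self)
  have hlim : Tendsto (fun α : ℝ => c + ENNReal.ofReal α * (c * ENNReal.ofReal (max T₁ 1)))
      (nhdsWithin 0 (Set.Ioi (0 : ℝ))) (𝓝 c) := by
    have h0 : Tendsto (fun α : ℝ => ENNReal.ofReal α) (nhdsWithin 0 (Set.Ioi (0 : ℝ)))
        (𝓝 0) := by
      have := (ENNReal.continuous_ofReal.tendsto 0).mono_left
        (nhdsWithin_le_nhds (s := Set.Ioi (0:ℝ)))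
      simpa using this
    have h1 := ENNReal.Tendsto.mul_const (b := c * ENNReal.ofReal (max T₁ 1)) h0
      (Or.inr (ENNReal.mul_ne_top hct ofReal_ne_top))
    simpa using h1.const_add c
  rw [← hlim.limsup_eq]
  refine limsup_le_limsup ?_
  filter_upwards [self_mem_nhdsWithin] with α hα using hb α hα
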